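/- arXiv:1810.01583 — 2 statements merged into one kernel-verified Lean document; each statement's English description precedes it below -/
import Mathlib

section
/- For every even integer n ≥ 6, the wheel graph W_n is minimally unlabellable: W_n is not labellable, but every proper induced subgraph of W_n is labellable. -/
/-- `H` is labellable: for some positive integer `k` the vertices of `H` can be
injectively labelled by `k`-element subsets of `ℕ` so that two distinct vertices
are adjacent if and only if their labels intersect in a set of size `k - 1`. -/
def Labellable {V : Type*} (H : SimpleGraph V) : Prop :=
  ∃ k : ℕ, 0 < k ∧ ∃ ℓ : V → Finset ℕ, Function.Injective ℓ ∧
    (∀ v, (ℓ v).card = k) ∧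
    ∀ u v : V, u ≠ v → (H.Adj u v ↔ (ℓ u ∩ ℓ v).card = k - 1)

/-- The wheel graph `W n` on `n` vertices: a hub vertex (`none`) joined to every
vertex of a cycle on `n - 1` vertices. -/
def wheelGraph (n : ℕ) : SimpleGraph (Option (Fin (n - 1))) :=
  SimpleGraph.fromRel (fun a b =>
    a = none ∨ b = none ∨
      ∃ i j : Fin (n - 1), a = some i ∧ b = some j ∧ (i.val + 1) % (n - 1) = j.val)

/-- The set obtained from `A` by removing `a` and adding `b`. -/
def Finset.exchange (A : Finset ℕ) (a b : ℕ) : Finset ℕ := insert b (A.erase a)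

theorem Finset.mem_exchange {A : Finset ℕ} {a b x : ℕ} :
    x ∈ A.exchange a b ↔ x = b ∨ x ≠ a ∧ x ∈ A := by
  simp [Finset.exchange]

theorem Finset.card_exchange {A : Finset ℕ} {a b : ℕ} (ha : a ∈ A) (hb : b ∉ A) :
    (A.exchange a b).card = A.card := by
  have hpos : 0 < A.card := Finset.card_pos.mpr ⟨a, ha⟩
  rw [Finset.exchange, Finset.card_insert_of_notMem (by simp [hb]), Finset.card_erase_of_mem ha]
  omega

theorem Finset.exchange_injective {A : Finset ℕ} {a b a' b' : ℕ} (ha : a ∈ A) (hb : b ∉ A)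
    (h : A.exchange a b = A.exchange a' b') : a = a' ∧ b = b' := by
  have h₁ := Finset.ext_iff.mp h a
  have h₂ := Finset.ext_iff.mp h b
  simp only [Finset.mem_exchange] at h₁ h₂
  constructor
  · by_contra hne
    have : a ≠ b := fun e => hb (e ▸ ha)
    tauto
  · tauto

theorem Finset.card_inter_exchange {A : Finset ℕ} {a b : ℕ} (ha : a ∈ A) (hb : b ∉ A) :
    (A ∩ A.exchange a b).card = A.card - 1 := by
  have : A ∩ A.exchange a b = A.erase a := by
    ext x
    simp only [Finset.mem_inter, Finset.mem_exchange, Finset.mem_erase]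
    grind
  rw [this, Finset.card_erase_of_mem ha]

theorem Finset.card_exchange_inter_exchange {A : Finset ℕ} {a b a' b' : ℕ}
    (ha : a ∈ A) (hb : b ∉ A) (ha' : a' ∈ A) (hb' : b' ∉ A) (hne : ¬ (a = a' ∧ b = b')) :
    (A.exchange a b ∩ A.exchange a' b').card = A.card - 1 ↔ a = a' ∨ b = b' := by
  by_cases h : a = a'
  · subst h
    have : A.exchange a b ∩ A.exchange a b' = A.erase a := by
      ext x
      simp only [Finset.mem_inter, Finset.mem_exchange, Finset.mem_erase]
      grind
    simp [this, Finset.card_erase_of_mem ha]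
  · have hcard : ((A.erase a).erase a').card + 2 = A.card := by
      have h₁ := Finset.card_erase_add_one (s := A.erase a) (a := a') (by grind)
      have h₂ := Finset.card_erase_add_one ha
      omega
    by_cases h' : b = b'
    · subst h'
      have : A.exchange a b ∩ A.exchange a' b = insert b ((A.erase a).erase a') := by
        ext x
        simp only [Finset.mem_inter, Finset.mem_exchange, Finset.mem_erase, Finset.mem_insert]
        grind
      rw [this, Finset.card_insert_of_notMem (by simp [hb])]
      simp only [or_true, iff_true]
      omega
    · have : A.exchange a b ∩ A.exchange a' b' = (A.erase a).erase a' := by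
        ext x
        simp only [Finset.mem_inter, Finset.mem_exchange, Finset.mem_erase]
        grind
      rw [this]
      simp only [h, h', or_self, iff_false]
      omega

theorem Finset.exists_eq_exchange {A B : Finset ℕ} (hpos : 0 < A.card) (hcard : B.card = A.card)
    (h : (A ∩ B).card = A.card - 1) : ∃ a ∈ A, ∃ b ∉ A, B = A.exchange a b := by
  have h₁ := Finset.card_sdiff_add_card_inter A B
  have h₂ := Finset.card_sdiff_add_card_inter B A
  rw [Finset.inter_comm] at h₂
  obtain ⟨a, ha⟩ := Finset.card_eq_one.mp (show (A \ B).card = 1 by omega)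
  obtain ⟨b, hb⟩ := Finset.card_eq_one.mp (show (B \ A).card = 1 by omega)
  simp only [Finset.ext_iff, Finset.mem_sdiff, Finset.mem_singleton] at ha hb
  refine ⟨a, ((ha a).mpr rfl).1, b, ((hb b).mpr rfl).2, ?_⟩
  ext x
  rw [Finset.mem_exchange]
  have := ha x
  have := hb x
  tauto

theorem Nat.add_one_mod_cases {m : ℕ} (hm : 0 < m) (t : ℕ) :
    t % m + 1 = m ∧ (t + 1) % m = 0 ∨ t % m + 1 < m ∧ (t + 1) % m = t % m + 1 := by
  have ht := Nat.mod_lt t hm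
  rw [← Nat.mod_add_mod]
  by_cases h : t % m + 1 = m
  · exact Or.inl ⟨h, by rw [h, Nat.mod_self]⟩
  · exact Or.inr ⟨by omega, Nat.mod_eq_of_lt (by omega)⟩

theorem wheelGraph_adj_none_some {n : ℕ} (i : Fin (n - 1)) :
    (wheelGraph n).Adj none (some i) := by
  simp [wheelGraph]

theorem wheelGraph_adj_some_some {n : ℕ} (i j : Fin (n - 1)) :
    (wheelGraph n).Adj (some i) (some j) ↔
      i ≠ j ∧ ((i.val + 1) % (n - 1) = j.val ∨ (j.val + 1) % (n - 1) = i.val) := by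
  simp [wheelGraph]

/-- A cyclic sequence of pairs of odd length has two consecutive or two next-to-consecutive
terms that violate the adjacency pattern of an induced cycle in a rook's graph. -/
theorem not_odd_cycle_in_rook_graph {F G : ℕ → ℕ} {m : ℕ} (hm : Odd m)
    (hF : F m = F 0) (hF' : F (m + 1) = F 1)
    (hadj : ∀ t, F t = F (t + 1) ∨ G t = G (t + 1))
    (hnon : ∀ t, F t ≠ F (t + 2) ∧ G t ≠ G (t + 2)) : False := by
  have step : ∀ t, F (t + 1) = F (t + 2) ↔ ¬ F t = F (t + 1) := by
    intro t
    have h₁ := hadj t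
    have h₂ := hadj (t + 1)
    have h₃ := hnon t
    grind
  have parity : ∀ t, F t = F (t + 1) ↔ (Even t ↔ F 0 = F 1) := by
    intro t
    induction t with
    | zero => simp
    | succ t ih =>
      rw [step, ih, Nat.even_add_one]
      tauto
  have := parity m
  rw [hF, hF'] at this
  have := Nat.not_even_iff_odd.mpr hm
  tauto

theorem not_labellable_wheelGraph {n : ℕ} (hn : 6 ≤ n) (heven : Even n) :
    ¬ Labellable (wheelGraph n) := by
  rintro ⟨k, hk, ℓ, hinj, hcard, hadj⟩
  have hm : 0 < n - 1 := by omega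
  have hex : ∀ i : Fin (n - 1), ∃ a ∈ ℓ none, ∃ b ∉ ℓ none,
      ℓ (some i) = (ℓ none).exchange a b := by
    intro i
    have := (hadj none (some i) (by simp)).mp (wheelGraph_adj_none_some i)
    exact Finset.exists_eq_exchange (by rw [hcard]; exact hk) (by rw [hcard, hcard])
      (by rw [this, hcard])
  choose f hf g hg hfg using hex
  have key : ∀ i j : Fin (n - 1), i ≠ j →
      ((wheelGraph n).Adj (some i) (some j) ↔ f i = f j ∨ g i = g j) := by
    intro i j hij
    rw [hadj _ _ (by simpa using hij), hfg i, hfg j, ← hcard none]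
    refine Finset.card_exchange_inter_exchange (hf i) (hg i) (hf j) (hg j) ?_
    rintro ⟨h₁, h₂⟩
    refine hij (Option.some_injective _ (hinj ?_))
    rw [hfg i, hfg j, h₁, h₂]
  let c : ℕ → Fin (n - 1) := fun t => ⟨t % (n - 1), Nat.mod_lt t hm⟩
  have hodd : Odd (n - 1) := by
    obtain ⟨r, rfl⟩ := heven
    exact ⟨r - 1, by omega⟩
  refine not_odd_cycle_in_rook_graph (F := f ∘ c) (G := g ∘ c) hodd ?_ ?_ ?_ ?_
  · simp [c]
  · simp [c]
  · intro t
    have h₁ := Nat.add_one_mod_cases hm t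
    have hne : c t ≠ c (t + 1) := by
      simp only [c, ne_eq, Fin.mk.injEq]
      omega
    refine (key _ _ hne).mp ((wheelGraph_adj_some_some _ _).mpr ⟨hne, Or.inl ?_⟩)
    simp [c]
  · intro t
    have h₁ := Nat.add_one_mod_cases hm t
    have h₂ := Nat.add_one_mod_cases hm (t + 1)
    rw [add_assoc, one_add_one_eq_two] at h₂
    have h₃ := Nat.add_one_mod_cases hm (t + 2)
    have hne : c t ≠ c (t + 2) := by
      simp only [c, ne_eq, Fin.mk.injEq]
      omega
    have hnadj : ¬ (wheelGraph n).Adj (some (c t)) (some (c (t + 2))) := by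
      rw [wheelGraph_adj_some_some]
      simp only [c, Nat.mod_add_mod, ne_eq, Fin.mk.injEq]
      omega
    rw [key _ _ hne] at hnadj
    exact not_or.mp hnadj

theorem Labellable.induce_mono {V : Type*} {G : SimpleGraph V} {s t : Set V} (hst : s ⊆ t)
    (h : Labellable (G.induce t)) : Labellable (G.induce s) := by
  obtain ⟨k, hk, ℓ, hinj, hcard, hadj⟩ := h
  refine ⟨k, hk, fun v => ℓ ⟨v, hst v.2⟩, ?_, fun v => hcard _, ?_⟩
  · intro u v huv
    simpa [Subtype.ext_iff] using hinj huv
  · intro u v huv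
    exact hadj ⟨u, hst u.2⟩ ⟨v, hst v.2⟩ (by simpa [Subtype.ext_iff] using huv)

theorem labellable_wheelGraph_induce_rim {n : ℕ} (hn : 5 ≤ n) :
    Labellable ((wheelGraph n).induce {none}ᶜ) := by
  have hm : 0 < n - 1 := by omega
  let ℓ : Option (Fin (n - 1)) → Finset ℕ :=
    fun x => x.elim ∅ fun i => {i.val, (i.val + 1) % (n - 1)}
  have hcard : ∀ i : Fin (n - 1), (ℓ (some i)).card = 2 := by
    intro i
    have h₁ := Nat.add_one_mod_cases hm i.val
    rw [Nat.mod_eq_of_lt i.isLt] at h₁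
    exact Finset.card_pair (by omega)
  have hadj : ∀ i j : Fin (n - 1), i ≠ j → ((wheelGraph n).Adj (some i) (some j) ↔
      (ℓ (some i) ∩ ℓ (some j)).card = 1) := by
    intro i j hij
    have hij' : i.val ≠ j.val := fun h => hij (Fin.ext h)
    have h₁ := Nat.add_one_mod_cases hm i.val
    have h₂ := Nat.add_one_mod_cases hm j.val
    rw [Nat.mod_eq_of_lt i.isLt] at h₁
    rw [Nat.mod_eq_of_lt j.isLt] at h₂
    have hi := i.isLt
    have hj := j.isLt
    rw [wheelGraph_adj_some_some]
    simp only [ℓ, Option.elim_some]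
    generalize (i.val + 1) % (n - 1) = i' at *
    generalize (j.val + 1) % (n - 1) = j' at *
    have hij'' : i' ≠ j' := by omega
    constructor
    · rintro ⟨-, h | h⟩
      · refine Finset.card_eq_one.mpr ⟨i', ?_⟩
        ext x
        simp only [Finset.mem_inter, Finset.mem_insert, Finset.mem_singleton]
        omega
      · refine Finset.card_eq_one.mpr ⟨j', ?_⟩
        ext x
        simp only [Finset.mem_inter, Finset.mem_insert, Finset.mem_singleton]
        omega
    · intro h
      obtain ⟨x, hx⟩ := Finset.card_eq_one.mp h
      have := (Finset.ext_iff.mp hx x).mpr (Finset.mem_singleton_self x)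
      simp only [Finset.mem_inter, Finset.mem_insert, Finset.mem_singleton] at this
      exact ⟨hij, by omega⟩
  refine ⟨2, two_pos, fun v => ℓ v, ?_, ?_, ?_⟩
  · rintro ⟨_ | i, hi⟩ ⟨_ | j, hj⟩ h
    · rfl
    · exact absurd rfl hi
    · exact absurd rfl hj
    · by_contra hne
      have hij : i ≠ j := fun e => hne (by subst e; rfl)
      have hi' := i.isLt
      have hj' := j.isLt
      have h₁ := Nat.add_one_mod_cases hm i.val
      have h₂ := Nat.add_one_mod_cases hm j.val
      rw [Nat.mod_eq_of_lt i.isLt] at h₁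
      rw [Nat.mod_eq_of_lt j.isLt] at h₂
      have e₁ := (Finset.ext_iff.mp h i.val).mp (Finset.mem_insert_self _ _)
      have e₂ := (Finset.ext_iff.mp h j.val).mpr (Finset.mem_insert_self _ _)
      simp only [ℓ, Option.elim_some, Finset.mem_insert, Finset.mem_singleton] at e₁ e₂
      have hij' : i.val ≠ j.val := fun h => hij (Fin.ext h)
      omega
  · rintro ⟨_ | i, hi⟩
    · exact absurd rfl hi
    · exact hcard i
  · rintro ⟨_ | i, hi⟩ ⟨_ | j, hj⟩ hne
    · exact absurd rfl hi
    · exact absurd rfl hi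
    · exact absurd rfl hj
    · exact hadj i j fun e => hne (by subst e; rfl)

theorem labellable_wheelGraph_induce_fan {n : ℕ} (v : Fin (n - 1)) :
    Labellable ((wheelGraph n).induce {some v}ᶜ) := by
  have hm : 0 < n - 1 := v.pos
  have hv := v.isLt
  let A : Finset ℕ := (Finset.range (n - 1)).image (2 * ·)
  have hA : A.card = n - 1 := by
    rw [Finset.card_image_of_injective _ (mul_right_injective₀ two_ne_zero), Finset.card_range]
  have hmem : ∀ x, 2 * x ∈ A ↔ x < n - 1 := by
    intro x
    simp [A]
  have hodd : ∀ x, 2 * x + 1 ∉ A := by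
    intro x
    simp only [A, Finset.mem_image, not_exists, not_and]
    intros
    omega
  let p : Fin (n - 1) → ℕ := fun i =>
    if v.val < i.val then i.val - v.val - 1 else i.val + (n - 1) - v.val - 1
  have hp : ∀ i, i ≠ v → p i + 1 < n - 1 := by
    intro i hi
    have hi' : i.val ≠ v.val := fun h => hi (Fin.ext h)
    have := i.isLt
    simp only [p]
    split_ifs <;> omega
  have hpinj : Function.Injective p := by
    intro i j h
    have := i.isLt
    have := j.isLt
    simp only [p] at h
    apply Fin.ext
    split_ifs at h <;> omega
  have hpadj : ∀ i j, i ≠ v → j ≠ v → i ≠ j →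
      ((wheelGraph n).Adj (some i) (some j) ↔ p i + 1 = p j ∨ p j + 1 = p i) := by
    intro i j hi hj hij
    have hi' : i.val ≠ v.val := fun h => hi (Fin.ext h)
    have hj' : j.val ≠ v.val := fun h => hj (Fin.ext h)
    have hij' : i.val ≠ j.val := fun h => hij (Fin.ext h)
    have := i.isLt
    have := j.isLt
    have h₁ := Nat.add_one_mod_cases hm i.val
    have h₂ := Nat.add_one_mod_cases hm j.val
    rw [Nat.mod_eq_of_lt i.isLt] at h₁
    rw [Nat.mod_eq_of_lt j.isLt] at h₂
    rw [wheelGraph_adj_some_some]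
    simp only [p, ne_eq, hij, not_false_eq_true, true_and]
    split_ifs <;> omega
  let a : Fin (n - 1) → ℕ := fun i => 2 * ((p i + 1) / 2)
  let b : Fin (n - 1) → ℕ := fun i => 2 * (p i / 2) + 1
  have ha : ∀ i, i ≠ v → a i ∈ A := by
    intro i hi
    have := hp i hi
    exact (hmem _).mpr (by omega)
  have hb : ∀ i, b i ∉ A := fun i => hodd _
  have hab : ∀ i j, i ≠ j → ¬ (a i = a j ∧ b i = b j) := by
    intro i j hij h
    refine hij (hpinj ?_)
    simp only [a, b] at h
    omega
  let ℓ : Option (Fin (n - 1)) → Finset ℕ := fun x => x.elim A fun i => A.exchange (a i) (b i)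
  have hne : ∀ {i : Fin (n - 1)}, some i ∈ ({some v}ᶜ : Set (Option (Fin (n - 1)))) → i ≠ v :=
    fun hi e => hi (congrArg some e)
  have hhub : ∀ i, A ≠ A.exchange (a i) (b i) := by
    intro i h
    exact hb i (by rw [h, Finset.mem_exchange]; exact Or.inl rfl)
  have hinter : ∀ i, i ≠ v → (A ∩ A.exchange (a i) (b i)).card = n - 1 - 1 := by
    intro i hi
    rw [Finset.card_inter_exchange (ha i hi) (hb i), hA]
  refine ⟨n - 1, hm, fun x => ℓ x, ?_, ?_, ?_⟩
  · rintro ⟨_ | i, hi⟩ ⟨_ | j, hj⟩ h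
    · rfl
    · exact absurd h (hhub j)
    · exact absurd h.symm (hhub i)
    · by_contra hij
      exact hab i j (fun e => hij (by subst e; rfl))
        (Finset.exchange_injective (ha i (hne hi)) (hb i) h)
  · rintro ⟨_ | i, hi⟩
    · exact hA
    · exact (Finset.card_exchange (ha i (hne hi)) (hb i)).trans hA
  · rintro ⟨_ | i, hi⟩ ⟨_ | j, hj⟩ hij
    · exact absurd rfl hij
    · exact iff_of_true (wheelGraph_adj_none_some j) (hinter j (hne hj))
    · rw [Finset.inter_comm]
      exact iff_of_true (wheelGraph_adj_none_some i).symm (hinter i (hne hi))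
    · have hij' : i ≠ j := fun e => hij (by subst e; rfl)
      have hpne : p i ≠ p j := fun e => hij' (hpinj e)
      have hcard := Finset.card_exchange_inter_exchange (ha i (hne hi)) (hb i) (ha j (hne hj)) (hb j)
        (hab i j hij')
      rw [hA] at hcard
      refine (hpadj i j (hne hi) (hne hj) hij').trans (Iff.trans ?_ hcard.symm)
      simp only [a, b]
      omega

/-- For every even integer `n ≥ 6`, the wheel graph `W_n` is minimally
unlabellable: `W_n` is not labellable, but every proper induced subgraph of
`W_n` is labellable. -/
theorem wheel_even_minimally_unlabellable (n : ℕ) (hn : 6 ≤ n) (heven : Even n) :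
    ¬ Labellable (wheelGraph n) ∧
      ∀ s : Set (Option (Fin (n - 1))), s ≠ Set.univ →
        Labellable ((wheelGraph n).induce s) := by
  refine ⟨not_labellable_wheelGraph hn heven, fun s hs => ?_⟩
  obtain ⟨x, hx⟩ := (Set.ne_univ_iff_exists_notMem s).mp hs
  refine Labellable.induce_mono (Set.subset_compl_singleton_iff.mpr hx) ?_
  cases x with
  | none => exact labellable_wheelGraph_induce_rim (by omega)
  | some v => exact labellable_wheelGraph_induce_fan v
end

section
/- A finite simple graph on at most five vertices is labellable if and only if it contains no induced subgraph isomorphic to any of the following four graphs: the complete bipartite graph K_{2,3}; the fan graph F_{3,2}; the complement of the disjoint union of K_2 and the path P_3; and the complete graph K_5 with one edge deleted. -/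
/-- The fan graph `F_{m,n}`: `m` vertices (`Sum.inl`), each joined to every vertex
of a path on `n` vertices (`Sum.inr`, consecutive ones adjacent), with the `m`
vertices pairwise nonadjacent. -/
def fanGraph (m n : ℕ) : SimpleGraph (Fin m ⊕ Fin n) :=
  SimpleGraph.fromRel (fun a b =>
    (∃ i j, a = Sum.inl i ∧ b = Sum.inr j) ∨
    (∃ i j : Fin n, a = Sum.inr i ∧ b = Sum.inr j ∧ i.val + 1 = j.val))

/-- The disjoint union of `K₂` (on vertices `0, 1`) and the path `P₃` (on
vertices `2, 3, 4`, with edges `2-3` and `3-4`), as a graph on `Fin 5`. -/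
def K2PlusP3 : SimpleGraph (Fin 5) :=
  SimpleGraph.fromRel (fun a b =>
    (a = 0 ∧ b = 1) ∨ (a = 2 ∧ b = 3) ∨ (a = 3 ∧ b = 4))

/-- The complete graph `K₅` with the single edge `{0,1}` deleted. -/
def K5minusEdge : SimpleGraph (Fin 5) :=
  SimpleGraph.fromRel (fun a b => ¬ ((a = 0 ∧ b = 1) ∨ (a = 1 ∧ b = 0)))

section JohnsonGraph

variable {A B U V Y : Finset ℕ} {k p q p' q' : ℕ}

/-- Two `k`-sets meeting in `k - 1` points differ by exchanging one element. -/
lemma exists_exchange_of_card_inter (hk : 0 < k) (hA : A.card = k) (hB : B.card = k)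
    (h : (A ∩ B).card = k - 1) :
    ∃ p ∈ A, ∃ q ∉ A, B = insert q (A.erase p) := by
  have h1 : (A \ B).card = 1 := by
    have := Finset.card_inter_add_card_sdiff A B
    omega
  have h2 : (B \ A).card = 1 := by
    have := Finset.card_inter_add_card_sdiff B A
    rw [Finset.inter_comm] at this
    omega
  obtain ⟨p, hp⟩ := Finset.card_eq_one.mp h1
  obtain ⟨q, hq⟩ := Finset.card_eq_one.mp h2
  rw [Finset.ext_iff] at hp hq
  simp only [Finset.mem_sdiff, Finset.mem_singleton] at hp hq
  refine ⟨p, ((hp p).2 rfl).1, q, ((hq q).2 rfl).2, ?_⟩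
  ext a
  have := hp a
  have := hq a
  simp only [Finset.mem_insert, Finset.mem_erase]
  tauto

/-- Neighbours of a vertex of a Johnson graph form a rook's graph. -/
lemma card_exchange_inter_exchange (hA : A.card = k) (hp : p ∈ A) (hp' : p' ∈ A)
    (hq : q ∉ A) (hq' : q' ∉ A) :
    (insert q (A.erase p) ∩ insert q' (A.erase p')).card = k - 1 ↔ (p = p' ↔ q ≠ q') := by
  have hk : 0 < k := hA ▸ Finset.card_pos.mpr ⟨p, hp⟩
  have hcard : ((A.erase p).erase p').card = if p = p' then k - 1 else k - 2 := by
    split_ifs with h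
    · subst h
      simp [Finset.card_erase_of_mem hp, hA]
    · rw [Finset.card_erase_of_mem (by simp [hp', Ne.symm h]), Finset.card_erase_of_mem hp, hA]
      omega
  by_cases hqq : q = q'
  · subst hqq
    have : insert q (A.erase p) ∩ insert q (A.erase p') = insert q ((A.erase p).erase p') := by
      ext; simp only [Finset.mem_inter, Finset.mem_insert, Finset.mem_erase]; tauto
    rw [this, Finset.card_insert_of_notMem (by simp [hq]), hcard]
    by_cases h : p = p'
    · simp only [h, if_true]
      simp
    · have : 1 < A.card := Finset.one_lt_card.mpr ⟨p, hp, p', hp', h⟩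
      simp only [h, if_false]
      simp
      omega
  · have : insert q (A.erase p) ∩ insert q' (A.erase p') = (A.erase p).erase p' := by
      ext a; simp only [Finset.mem_inter, Finset.mem_insert, Finset.mem_erase]
      constructor
      · rintro ⟨rfl | h1, rfl | h2⟩ <;> tauto
      · tauto
    rw [this, hcard]
    by_cases h : p = p'
    · simp [h, hqq]
    · have : 1 < A.card := Finset.one_lt_card.mpr ⟨p, hp, p', hp', h⟩
      simp only [h, if_false]
      simp
      omega

/-- A common neighbour of two vertices at distance two of a Johnson graph arises from the
first one by exchanging elements of the two differences. -/
lemma exists_exchange_of_common_neighbor (hk : 0 < k) (hU : U.card = k) (hV : V.card = k)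
    (hY : Y.card = k) (hUV : U ≠ V) (h : (U ∩ V).card ≠ k - 1)
    (hUY : (U ∩ Y).card = k - 1) (hVY : (V ∩ Y).card = k - 1) :
    (U \ V).card = 2 ∧ (V \ U).card = 2 ∧
      ∃ p ∈ U \ V, ∃ q ∈ V \ U, Y = insert q (U.erase p) := by
  obtain ⟨p, hp, q, hq, rfl⟩ := exists_exchange_of_card_inter hk hU hY hUY
  have hlt : (U ∩ V).card < k := by
    refine lt_of_le_of_ne (hU ▸ Finset.card_le_card Finset.inter_subset_left) fun h' => hUV ?_
    have h1 : U ∩ V = U := Finset.eq_of_subset_of_card_le Finset.inter_subset_left (by omega)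
    exact Finset.eq_of_subset_of_card_le (Finset.inter_eq_left.mp h1) (by omega)
  have hle : (V ∩ insert q (U.erase p)).card ≤
      (V ∩ U.erase p).card + if q ∈ V then 1 else 0 := by
    split_ifs with hqV
    · rw [Finset.inter_insert_of_mem hqV]
      exact Finset.card_insert_le _ _
    · rw [Finset.inter_insert_of_notMem hqV]
      simp
  have herase : (V ∩ U.erase p) = (U ∩ V).erase p := by
    ext; simp only [Finset.mem_inter, Finset.mem_erase]; tauto
  rw [herase, hVY] at hle
  have hpV : p ∉ V := by
    intro hpV
    have hmem : p ∈ U ∩ V := Finset.mem_inter.mpr ⟨hp, hpV⟩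
    have := Finset.card_pos.mpr ⟨p, hmem⟩
    rw [Finset.card_erase_of_mem hmem] at hle
    split_ifs at hle <;> omega
  rw [Finset.erase_eq_of_notMem (by simp [hpV])] at hle
  have hqV : q ∈ V := by
    by_contra hqV
    simp only [hqV, if_false] at hle
    omega
  simp only [hqV, if_true] at hle
  have h1 := Finset.card_inter_add_card_sdiff U V
  have h2 := Finset.card_inter_add_card_sdiff V U
  rw [Finset.inter_comm] at h2
  have h0 : k ≠ 1 := by rintro rfl; omega
  exact ⟨by omega, by omega, p, by simp [hp, hpV], q, by simp [hq, hqV], rfl⟩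

end JohnsonGraph

section Obstructions

variable {V W : Type*} {G : SimpleGraph V} {H : SimpleGraph W}

lemma Labellable.of_embedding (h : Labellable H) (f : G ↪g H) : Labellable G := by
  obtain ⟨k, hk, l, hinj, hcard, hadj⟩ := h
  refine ⟨k, hk, l ∘ f, hinj.comp f.injective, fun v => hcard _, fun u v huv => ?_⟩
  rw [← f.map_adj_iff]
  exact hadj _ _ (f.injective.ne huv)

/-- Any three common neighbours of two nonadjacent vertices induce a path. -/
lemma Labellable.common_neighbors (h : Labellable H) {u v x y z : W} (huv : u ≠ v)
    (hn : ¬ H.Adj u v) (hxy : x ≠ y) (hxz : x ≠ z) (hyz : y ≠ z)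
    (hux : H.Adj u x) (huy : H.Adj u y) (huz : H.Adj u z)
    (hvx : H.Adj v x) (hvy : H.Adj v y) (hvz : H.Adj v z) :
    (H.Adj x y ∧ H.Adj y z ∧ ¬ H.Adj x z) ∨ (H.Adj x y ∧ ¬ H.Adj y z ∧ H.Adj x z) ∨
      (¬ H.Adj x y ∧ H.Adj y z ∧ H.Adj x z) := by
  obtain ⟨k, hk, l, hinj, hcard, hadj⟩ := h
  have hxy' := hinj.ne hxy
  have hxz' := hinj.ne hxz
  have hyz' := hinj.ne hyz
  have key : ∀ w, H.Adj u w → H.Adj v w → _ := fun w huw hvw =>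
    exists_exchange_of_common_neighbor hk (hcard u) (hcard v) (hcard w) (hinj.ne huv)
      (fun h => hn ((hadj u v huv).2 h)) ((hadj u w huw.ne).1 huw) ((hadj v w hvw.ne).1 hvw)
  obtain ⟨hU, hV, p₁, hp₁, q₁, hq₁, h₁⟩ := key x hux hvx
  obtain ⟨-, -, p₂, hp₂, q₂, hq₂, h₂⟩ := key y huy hvy
  obtain ⟨-, -, p₃, hp₃, q₃, hq₃, h₃⟩ := key z huz hvz
  rw [hadj x y hxy, hadj x z hxz, hadj y z hyz]
  rw [h₁, h₂] at hxy'
  rw [h₁, h₃] at hxz'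
  rw [h₂, h₃] at hyz'
  rw [h₁, h₂, h₃]
  obtain ⟨a, c, hac, hU⟩ := Finset.card_eq_two.mp hU
  obtain ⟨b, d, hbd, hV⟩ := Finset.card_eq_two.mp hV
  have mem₁ := Finset.mem_sdiff.mp hp₁
  have mem₂ := Finset.mem_sdiff.mp hp₂
  have mem₃ := Finset.mem_sdiff.mp hp₃
  have nmem₁ := Finset.mem_sdiff.mp hq₁
  have nmem₂ := Finset.mem_sdiff.mp hq₂
  have nmem₃ := Finset.mem_sdiff.mp hq₃
  rw [card_exchange_inter_exchange (hcard u) mem₁.1 mem₂.1 nmem₁.2 nmem₂.2,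
    card_exchange_inter_exchange (hcard u) mem₁.1 mem₃.1 nmem₁.2 nmem₃.2,
    card_exchange_inter_exchange (hcard u) mem₂.1 mem₃.1 nmem₂.2 nmem₃.2]
  have e₁ : ¬ (p₁ = p₂ ∧ q₁ = q₂) := by rintro ⟨rfl, rfl⟩; exact hxy' rfl
  have e₂ : ¬ (p₁ = p₃ ∧ q₁ = q₃) := by rintro ⟨rfl, rfl⟩; exact hxz' rfl
  have e₃ : ¬ (p₂ = p₃ ∧ q₂ = q₃) := by rintro ⟨rfl, rfl⟩; exact hyz' rfl
  simp only [hU, Finset.mem_insert, Finset.mem_singleton] at hp₁ hp₂ hp₃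
  simp only [hV, Finset.mem_insert, Finset.mem_singleton] at hq₁ hq₂ hq₃
  clear hxy' hxz' hyz' key mem₁ mem₂ mem₃ nmem₁ nmem₂ nmem₃ h₁ h₂ h₃
  grind

/-- Two adjacent vertices do not have three pairwise nonadjacent common neighbours. -/
lemma Labellable.not_three_independent (h : Labellable H) {u w x y z : W}
    (hxy : x ≠ y) (hxz : x ≠ z) (hyz : y ≠ z) (huw : H.Adj u w)
    (hux : H.Adj u x) (huy : H.Adj u y) (huz : H.Adj u z)
    (hwx : H.Adj w x) (hwy : H.Adj w y) (hwz : H.Adj w z)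
    (nxy : ¬ H.Adj x y) (nxz : ¬ H.Adj x z) (nyz : ¬ H.Adj y z) : False := by
  obtain ⟨k, hk, l, hinj, hcard, hadj⟩ := h
  have hxy' := hinj.ne hxy
  have hxz' := hinj.ne hxz
  have hyz' := hinj.ne hyz
  have key : ∀ a, H.Adj u a → _ := fun a hua =>
    exists_exchange_of_card_inter hk (hcard u) (hcard a) ((hadj u a hua.ne).1 hua)
  obtain ⟨p, hp, q, hq, h⟩ := key w huw
  obtain ⟨p₁, hp₁, q₁, hq₁, h₁⟩ := key x hux
  obtain ⟨p₂, hp₂, q₂, hq₂, h₂⟩ := key y huy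
  obtain ⟨p₃, hp₃, q₃, hq₃, h₃⟩ := key z huz
  rw [hadj w x hwx.ne, h, h₁, card_exchange_inter_exchange (hcard u) hp hp₁ hq hq₁] at hwx
  rw [hadj w y hwy.ne, h, h₂, card_exchange_inter_exchange (hcard u) hp hp₂ hq hq₂] at hwy
  rw [hadj w z hwz.ne, h, h₃, card_exchange_inter_exchange (hcard u) hp hp₃ hq hq₃] at hwz
  rw [hadj x y hxy, h₁, h₂, card_exchange_inter_exchange (hcard u) hp₁ hp₂ hq₁ hq₂] at nxy
  rw [hadj x z hxz, h₁, h₃, card_exchange_inter_exchange (hcard u) hp₁ hp₃ hq₁ hq₃] at nxz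
  rw [hadj y z hyz, h₂, h₃, card_exchange_inter_exchange (hcard u) hp₂ hp₃ hq₂ hq₃] at nyz
  have e₁ : ¬ (p₁ = p₂ ∧ q₁ = q₂) := by
    rintro ⟨rfl, rfl⟩; exact hxy' (h₁.trans h₂.symm)
  have e₂ : ¬ (p₁ = p₃ ∧ q₁ = q₃) := by
    rintro ⟨rfl, rfl⟩; exact hxz' (h₁.trans h₃.symm)
  have e₃ : ¬ (p₂ = p₃ ∧ q₂ = q₃) := by
    rintro ⟨rfl, rfl⟩; exact hyz' (h₂.trans h₃.symm)
  clear hxy' hxz' hyz' key h h₁ h₂ h₃ hp hp₁ hp₂ hp₃ hq hq₁ hq₂ hq₃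
  grind

lemma not_labellable_completeBipartiteGraph :
    ¬ Labellable (completeBipartiteGraph (Fin 2) (Fin 3)) := fun h => by
  simpa using h.common_neighbors (u := .inl 0) (v := .inl 1) (x := .inr 0) (y := .inr 1)
    (z := .inr 2) (by simp) (by simp) (by simp) (by simp) (by simp)
    (by simp) (by simp) (by simp) (by simp) (by simp) (by simp)

lemma not_labellable_fanGraph : ¬ Labellable (fanGraph 3 2) := fun h =>
  h.not_three_independent (u := .inr 0) (w := .inr 1) (x := .inl 0) (y := .inl 1) (z := .inl 2)
    (by simp) (by simp) (by simp) (by simp [fanGraph]) (by simp [fanGraph]) (by simp [fanGraph])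
    (by simp [fanGraph]) (by simp [fanGraph]) (by simp [fanGraph]) (by simp [fanGraph])
    (by simp [fanGraph]) (by simp [fanGraph]) (by simp [fanGraph])

lemma not_labellable_compl_K2PlusP3 : ¬ Labellable K2PlusP3ᶜ := fun h => by
  simpa [K2PlusP3] using h.common_neighbors (u := 0) (v := 1) (x := 2) (y := 3) (z := 4)
    (by simp) (by simp [K2PlusP3]) (by simp) (by simp) (by simp)
    (by simp [K2PlusP3]) (by simp [K2PlusP3]) (by simp [K2PlusP3])
    (by simp [K2PlusP3]) (by simp [K2PlusP3]) (by simp [K2PlusP3])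

lemma not_labellable_K5minusEdge : ¬ Labellable K5minusEdge := fun h => by
  simpa [K5minusEdge] using h.common_neighbors (u := 0) (v := 1) (x := 2) (y := 3) (z := 4)
    (by simp) (by simp [K5minusEdge]) (by simp) (by simp) (by simp)
    (by simp [K5minusEdge]) (by simp [K5minusEdge]) (by simp [K5minusEdge])
    (by simp [K5minusEdge]) (by simp [K5minusEdge]) (by simp [K5minusEdge])

end Obstructions

section Classification

/-- The relation on `Fin 5` whose adjacency matrix has the binary digits of `c` as entries. -/
def matrixRel (c : ℕ) (i j : Fin 5) : Bool :=
  c.testBit (5 * i.val + j.val)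

/-- The entries above the diagonal of a relation on `Fin 5`, read as a number in binary. -/
def upperCode (r : Fin 5 → Fin 5 → Bool) : ℕ :=
  (r 0 1).toNat + 2 * (r 0 2).toNat + 4 * (r 0 3).toNat + 8 * (r 0 4).toNat +
    16 * (r 1 2).toNat + 32 * (r 1 3).toNat + 64 * (r 1 4).toNat +
    128 * (r 2 3).toNat + 256 * (r 2 4).toNat + 512 * (r 3 4).toNat

/-- Adjacency matrices of the labellable graphs on five vertices, up to isomorphism, each
with a labelling by four-element sets. -/
def labelledMatrices : List (ℕ × (Fin 5 → Finset ℕ)) :=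
  [
   (0, ![{0, 1, 2, 3}, {0, 1, 4, 5}, {0, 2, 4, 6}, {0, 3, 5, 6}, {1, 2, 5, 6}]),
   (34, ![{0, 1, 2, 3}, {0, 1, 2, 4}, {0, 1, 5, 6}, {0, 3, 4, 5}, {1, 3, 4, 6}]),
   (1062, ![{0, 1, 2, 3}, {0, 1, 2, 4}, {0, 1, 3, 5}, {0, 2, 5, 6}, {0, 3, 4, 6}]),
   (33838, ![{0, 1, 2, 3}, {0, 1, 2, 4}, {0, 1, 3, 5}, {0, 2, 3, 6}, {0, 4, 5, 6}]),
   (1082430, ![{0, 1, 2, 3}, {0, 1, 2, 4}, {0, 1, 3, 5}, {0, 2, 3, 6}, {1, 2, 3, 7}]),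
   (3238, ![{0, 1, 2, 3}, {0, 1, 2, 4}, {0, 1, 2, 5}, {0, 3, 4, 5}, {1, 3, 4, 6}]),
   (34952, ![{0, 1, 2, 3}, {0, 1, 4, 5}, {0, 1, 4, 6}, {0, 2, 3, 4}, {0, 2, 5, 6}]),
   (34986, ![{0, 1, 2, 3}, {0, 1, 2, 4}, {0, 1, 4, 5}, {0, 1, 3, 6}, {0, 2, 5, 6}]),
   (36014, ![{0, 1, 2, 3}, {0, 1, 2, 4}, {0, 1, 2, 5}, {0, 1, 3, 6}, {0, 3, 4, 5}]),
   (1083544, ![{0, 1, 2, 3}, {0, 1, 4, 5}, {0, 1, 4, 6}, {0, 2, 3, 4}, {1, 2, 3, 5}]),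
   (1083578, ![{0, 1, 2, 3}, {0, 1, 2, 4}, {0, 1, 4, 5}, {0, 1, 3, 6}, {0, 2, 3, 5}]),
   (1084606, ![{0, 1, 2, 3}, {0, 1, 2, 4}, {0, 1, 3, 4}, {0, 2, 3, 5}, {1, 2, 3, 6}]),
   (101772, ![{0, 1, 2, 3}, {0, 1, 4, 5}, {0, 1, 2, 4}, {0, 1, 3, 5}, {2, 3, 4, 5}]),
   (101806, ![{0, 1, 2, 3}, {0, 1, 2, 4}, {0, 1, 2, 5}, {0, 1, 3, 4}, {2, 3, 4, 5}]),
   (1117588, ![{0, 1, 2, 3}, {0, 1, 4, 5}, {0, 1, 2, 4}, {0, 3, 4, 5}, {1, 2, 3, 5}]),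
   (1117622, ![{0, 1, 2, 3}, {0, 1, 2, 4}, {0, 1, 3, 4}, {0, 2, 4, 5}, {1, 2, 3, 5}]),
   (1150364, ![{0, 1, 2, 3}, {0, 1, 4, 5}, {0, 1, 2, 4}, {0, 1, 3, 5}, {0, 2, 3, 6}]),
   (1150398, ![{0, 1, 2, 3}, {0, 1, 2, 4}, {0, 1, 2, 5}, {0, 1, 3, 4}, {0, 2, 3, 6}]),
   (241070, ![{0, 1, 2, 3}, {0, 1, 2, 4}, {0, 1, 2, 5}, {0, 1, 2, 6}, {0, 3, 4, 5}]),
   (1255824, ![{0, 1, 2, 3}, {0, 1, 4, 5}, {0, 2, 4, 5}, {0, 3, 4, 5}, {1, 2, 3, 4}]),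
   (1255858, ![{0, 1, 2, 3}, {0, 1, 2, 4}, {0, 1, 4, 5}, {0, 2, 4, 5}, {1, 2, 3, 5}]),
   (1256886, ![{0, 1, 2, 3}, {0, 1, 2, 4}, {0, 1, 3, 4}, {0, 1, 4, 5}, {0, 2, 3, 5}]),
   (1289662, ![{0, 1, 2, 3}, {0, 1, 2, 4}, {0, 1, 3, 4}, {0, 2, 3, 4}, {1, 2, 3, 5}]),
   (3319358, ![{0, 1, 2, 3}, {0, 1, 2, 4}, {0, 1, 3, 5}, {0, 2, 3, 5}, {1, 2, 3, 4}]),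
   (3320472, ![{0, 1, 2, 3}, {0, 1, 4, 5}, {0, 2, 4, 5}, {0, 2, 3, 4}, {0, 1, 3, 5}]),
   (3320506, ![{0, 1, 2, 3}, {0, 1, 2, 4}, {0, 1, 4, 5}, {0, 1, 3, 5}, {0, 2, 3, 4}]),
   (3321534, ![{0, 1, 2, 3}, {0, 1, 2, 4}, {0, 1, 2, 5}, {0, 1, 3, 5}, {0, 2, 3, 4}]),
   (3387326, ![{0, 1, 2, 3}, {0, 1, 2, 4}, {0, 1, 3, 4}, {0, 2, 3, 4}, {0, 1, 2, 5}]),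
   (7595838, ![{0, 1, 2, 3}, {0, 1, 2, 4}, {0, 1, 3, 5}, {0, 1, 2, 5}, {0, 1, 3, 4}]),
   (16510910, ![{0, 1, 2, 3}, {0, 1, 2, 4}, {0, 1, 3, 4}, {0, 2, 3, 4}, {1, 2, 3, 4}])]

/-- Adjacency matrices of the four forbidden graphs. -/
def forbiddenMatrices : List ℕ :=
  [3248028, 16507672, 7458716, 16510876]

/-- Adjacency matrices of all graphs on five vertices, up to isomorphism. -/
def representativeMatrices : List ℕ :=
  forbiddenMatrices ++ labelledMatrices.map Prod.fst

/-- The permutations of `Fin 5`, as lists of values. -/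
def permLists : List (List (Fin 5)) :=
  List.permutations' [0, 1, 2, 3, 4]

lemma permLists_injective {l : List (Fin 5)} (hl : l ∈ permLists) :
    Function.Injective fun i : Fin 5 => l.getD i.val 0 := by
  have hperm : l.Perm [0, 1, 2, 3, 4] := List.mem_permutations'.mp hl
  have hlen : l.length = 5 := hperm.length_eq
  have hnodup : l.Nodup := hperm.nodup_iff.mpr (by decide)
  intro i j hij
  have hi : i.val < l.length := by omega
  have hj : j.val < l.length := by omega
  simp only [List.getD_eq_getElem _ _ hi, List.getD_eq_getElem _ _ hj] at hij
  exact Fin.ext ((hnodup.getElem_inj_iff).mp hij)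

lemma labelledMatrices_spec : ∀ t ∈ labelledMatrices, Function.Injective t.2 ∧
    (∀ i, (t.2 i).card = 4) ∧
    ∀ i j, i ≠ j → (matrixRel t.1 i j = true ↔ (t.2 i ∩ t.2 j).card = 3) := by
  decide +kernel

lemma representativeMatrices_symm_irrefl : ∀ c ∈ representativeMatrices,
    (∀ i j, matrixRel c i j = matrixRel c j i) ∧ ∀ i, matrixRel c i i = false := by
  decide +kernel

/-- The upper triangular code of the rearrangement of an adjacency matrix by a list of values. -/
def rearrangedCode (c : ℕ) (l : List (Fin 5)) : ℕ :=
  upperCode fun i j => matrixRel c (l.getD i.val 0) (l.getD j.val 0)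

lemma exists_testBit_of_testBit_foldr {ι : Type*} (f : ι → ℕ) (L : List ι) {n : ℕ}
    (h : (L.foldr (fun x a => f x ||| a) 0).testBit n = true) :
    ∃ x ∈ L, (f x).testBit n = true := by
  induction L with
  | nil => simp at h
  | cons x L ih =>
    rw [List.foldr_cons, Nat.testBit_or, Bool.or_eq_true] at h
    rcases h with h | h
    · exact ⟨x, by simp, h⟩
    · obtain ⟨y, hy, h⟩ := ih h
      exact ⟨y, by simp [hy], h⟩

lemma exists_rearrangedCode_eq {n : ℕ} (hn : n < 1024) :
    ∃ c ∈ representativeMatrices, ∃ l ∈ permLists, rearrangedCode c l = n := by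
  have h : representativeMatrices.foldr (fun c a =>
      (permLists.foldr (fun l b => 2 ^ rearrangedCode c l ||| b) 0) ||| a) 0 = 2 ^ 1024 - 1 := by
    decide +kernel
  have hbit : (2 ^ 1024 - 1).testBit n = true := by
    rw [Nat.testBit_two_pow_sub_one]
    simpa using hn
  rw [← h] at hbit
  obtain ⟨c, hc, hbit⟩ := exists_testBit_of_testBit_foldr _ _ hbit
  obtain ⟨l, hl, hbit⟩ := exists_testBit_of_testBit_foldr _ _ hbit
  rw [Nat.testBit_two_pow, decide_eq_true_eq] at hbit
  exact ⟨c, hc, l, hl, hbit⟩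

lemma upperCode_lt (r : Fin 5 → Fin 5 → Bool) : upperCode r < 1024 := by
  have h : ∀ i j, (r i j).toNat ≤ 1 := fun i j => Bool.toNat_le _
  have := h 0 1; have := h 0 2; have := h 0 3; have := h 0 4; have := h 1 2
  have := h 1 3; have := h 1 4; have := h 2 3; have := h 2 4; have := h 3 4
  unfold upperCode
  omega

lemma eq_of_upperCode_eq {r s : Fin 5 → Fin 5 → Bool} (h : upperCode r = upperCode s)
    (hr : ∀ i j, r i j = r j i) (hs : ∀ i j, s i j = s j i)
    (hr' : ∀ i, r i i = false) (hs' : ∀ i, s i i = false) (i j : Fin 5) : r i j = s i j := by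
  have toNat_inj : ∀ {a b : Bool}, a.toNat = b.toNat → a = b := by decide
  have upper : ∀ i j, i < j → r i j = s i j := by
    have hr : ∀ i j, (r i j).toNat ≤ 1 := fun i j => Bool.toNat_le _
    have hs : ∀ i j, (s i j).toNat ≤ 1 := fun i j => Bool.toNat_le _
    have := hr 0 1; have := hr 0 2; have := hr 0 3; have := hr 0 4; have := hr 1 2
    have := hr 1 3; have := hr 1 4; have := hr 2 3; have := hr 2 4; have := hr 3 4
    have := hs 0 1; have := hs 0 2; have := hs 0 3; have := hs 0 4; have := hs 1 2
    have := hs 1 3; have := hs 1 4; have := hs 2 3; have := hs 2 4; have := hs 3 4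
    unfold upperCode at h
    intro i j hij
    apply toNat_inj
    fin_cases i <;> fin_cases j <;> first | exact absurd hij (by decide) | (dsimp; omega)
  rcases lt_trichotomy i j with hij | rfl | hij
  · exact upper i j hij
  · rw [hr', hs']
  · rw [hr, hs, upper j i hij]

lemma exists_representative (G : SimpleGraph (Fin 5)) :
    ∃ c ∈ representativeMatrices, ∃ σ : Fin 5 ≃ Fin 5,
      ∀ i j, G.Adj i j ↔ matrixRel c (σ i) (σ j) = true := by
  classical
  obtain ⟨c, hc, l, hl, h⟩ :=
    exists_rearrangedCode_eq (upperCode_lt fun i j => decide (G.Adj i j))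
  obtain ⟨hsymm, hirr⟩ := representativeMatrices_symm_irrefl c hc
  refine ⟨c, hc, Equiv.ofBijective _ (Finite.injective_iff_bijective.mp
    (permLists_injective hl)), fun i j => ?_⟩
  have := eq_of_upperCode_eq h (fun i j => hsymm _ _) (fun i j => by simp [G.adj_comm])
    (fun i => hirr _) (fun i => by simp) i j
  rw [Equiv.ofBijective_apply, Equiv.ofBijective_apply, this, decide_eq_true_eq]

/-- Graphs with the same adjacency matrix up to relabelling are isomorphic. -/
def isoOfMatrixRel {W : Type*} {G : SimpleGraph (Fin 5)} {F : SimpleGraph W} {c : ℕ}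
    (σ : Fin 5 ≃ Fin 5) (hσ : ∀ i j, G.Adj i j ↔ matrixRel c (σ i) (σ j) = true)
    (e : W ≃ Fin 5) (he : ∀ a b, F.Adj a b ↔ matrixRel c (e a) (e b) = true) : F ≃g G where
  toEquiv := e.trans σ.symm
  map_rel_iff' := by simp [hσ, he]

lemma labellable_or_iso_forbidden (G : SimpleGraph (Fin 5)) :
    Labellable G ∨ Nonempty (completeBipartiteGraph (Fin 2) (Fin 3) ≃g G) ∨
      Nonempty (fanGraph 3 2 ≃g G) ∨ Nonempty (K2PlusP3ᶜ ≃g G) ∨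
      Nonempty (K5minusEdge ≃g G) := by
  obtain ⟨c, hc, σ, hσ⟩ := exists_representative G
  rcases List.mem_append.mp hc with hc | hc
  · right
    simp only [forbiddenMatrices, List.mem_cons, List.not_mem_nil, or_false] at hc
    rcases hc with rfl | rfl | rfl | rfl
    · refine Or.inl ⟨isoOfMatrixRel σ hσ finSumFinEquiv ?_⟩
      simp only [completeBipartiteGraph_adj]
      decide
    · refine Or.inr (Or.inl ⟨isoOfMatrixRel σ hσ finSumFinEquiv ?_⟩)
      simp only [fanGraph, SimpleGraph.fromRel_adj]
      decide
    · refine Or.inr (Or.inr (Or.inl ⟨isoOfMatrixRel σ hσ (Equiv.refl _) ?_⟩))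
      simp only [K2PlusP3, SimpleGraph.compl_adj, SimpleGraph.fromRel_adj]
      decide
    · refine Or.inr (Or.inr (Or.inr ⟨isoOfMatrixRel σ hσ (Equiv.refl _) ?_⟩))
      simp only [K5minusEdge, SimpleGraph.fromRel_adj]
      decide
  · left
    obtain ⟨t, ht, rfl⟩ := List.mem_map.mp hc
    obtain ⟨hinj, hcard, hadj⟩ := labelledMatrices_spec t ht
    exact ⟨4, by norm_num, t.2 ∘ σ, hinj.comp σ.injective, fun v => hcard _, fun u v huv => by
      rw [hσ, hadj _ _ (σ.injective.ne huv)]; rfl⟩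

end Classification

/-- If the image of `H` under an embedding is isomorphic to a graph without isolated vertices,
then the embedding is onto and `H` itself is isomorphic to that graph. -/
lemma nonempty_iso_induce_univ_of_iso_map {V W X : Type*} {H : SimpleGraph V} (e : V ↪ X)
    {F : SimpleGraph W} (hF : ∀ a, ∃ b, F.Adj a b) (f : F ≃g H.map e) :
    Nonempty (F ≃g H.induce Set.univ) := by
  have hsurj : Function.Surjective e := by
    intro x
    obtain ⟨b, hb⟩ := hF (f.symm x)
    rw [← f.map_adj_iff, f.apply_symm_apply, SimpleGraph.map_adj] at hb
    obtain ⟨u, -, -, hu, -⟩ := hb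
    exact ⟨u, hu⟩
  let g : H ≃g H.map e := RelIso.ofSurjective (SimpleGraph.Embedding.map e H) hsurj
  exact ⟨(f.trans g.symm).trans (SimpleGraph.induceUnivIso H).symm⟩

/-- A finite simple graph on at most five vertices is labellable if and only if
it contains no induced subgraph isomorphic to any of: `K_{2,3}`, the fan graph
`F_{3,2}`, the complement of `K₂ ⊔ P₃`, and `K₅` minus an edge. -/
theorem labellable_iff_no_forbidden_induced_subgraph
    {V : Type*} [Fintype V] (H : SimpleGraph V) (hV : Fintype.card V ≤ 5) :
    Labellable H ↔
      (¬ ∃ s : Set V,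
        Nonempty ((completeBipartiteGraph (Fin 2) (Fin 3)) ≃g H.induce s)) ∧
      (¬ ∃ s : Set V, Nonempty (fanGraph 3 2 ≃g H.induce s)) ∧
      (¬ ∃ s : Set V, Nonempty (K2PlusP3ᶜ ≃g H.induce s)) ∧
      (¬ ∃ s : Set V, Nonempty (K5minusEdge ≃g H.induce s)) := by
  constructor
  · intro h
    refine ⟨?_, ?_, ?_, ?_⟩ <;> rintro ⟨s, ⟨f⟩⟩
    all_goals have hs := h.of_embedding ((SimpleGraph.Embedding.induce s).comp f.toEmbedding)
    · exact not_labellable_completeBipartiteGraph hs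
    · exact not_labellable_fanGraph hs
    · exact not_labellable_compl_K2PlusP3 hs
    · exact not_labellable_K5minusEdge hs
  · rintro ⟨h₁, h₂, h₃, h₄⟩
    obtain ⟨e⟩ : Nonempty (V ↪ Fin 5) :=
      Function.Embedding.nonempty_of_card_le (by simpa using hV)
    rcases labellable_or_iso_forbidden (H.map e) with h | ⟨⟨f⟩⟩ | ⟨⟨f⟩⟩ | ⟨⟨f⟩⟩ | ⟨⟨f⟩⟩
    · exact h.of_embedding (SimpleGraph.Embedding.map e H)
    · refine (h₁ ⟨_, nonempty_iso_induce_univ_of_iso_map e ?_ f⟩).elim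
      simp only [completeBipartiteGraph_adj]
      decide
    · refine (h₂ ⟨_, nonempty_iso_induce_univ_of_iso_map e ?_ f⟩).elim
      simp only [fanGraph, SimpleGraph.fromRel_adj]
      decide
    · refine (h₃ ⟨_, nonempty_iso_induce_univ_of_iso_map e ?_ f⟩).elim
      simp only [K2PlusP3, SimpleGraph.compl_adj, SimpleGraph.fromRel_adj]
      decide
    · refine (h₄ ⟨_, nonempty_iso_induce_univ_of_iso_map e ?_ f⟩).elim
      simp only [K5minusEdge, SimpleGraph.fromRel_adj]
      decide
end
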